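/- Let k be an algebraically closed field of characteristic p = 2 and let R = k⟦x,y,z⟧/(z^2 + x^3 + xy^3) (the rational double point of type E_7^0 in characteristic 2). Let τ := the Teichmüller lift of z/(xy) in 𝕎L, and let N_3 ⊆ 𝕎L be as in the context (with l = 3). Then: (i) F(τ) ∈ N_3; (ii) τ ∉ N_3; (iii) V(τ) ∉ N_3; (iv) V^2(τ) ∉ N_3. Equivalently, the class of the length-3 Teichmüller lift of z/(xy) in H^2_m(R, W_3O) is annihilated by Frobenius but not by V or V^2; this realizes the relations F ≡ V^3 ≡ 0 on the generator f_1^{(3)} of the Dieudonné module of E_7^0 in characteristic 2, which has length 3 (corresponding to Picloc^{loc,loc} ≅ α_8). -/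

import Mathlib

set_option maxHeartbeats 1000000
set_option synthInstance.maxHeartbeats 400000

open MvPowerSeries

noncomputable section

variable (k : Type) [Field k]

/-- The formal power series ring `k⟦x,y,z⟧`. -/
abbrev PS := MvPowerSeries (Fin 3) k

/-- The hypersurface singularity `R = k⟦x,y,z⟧/(f)`. -/
abbrev Rq (f : PS k) : Type := PS k ⧸ Ideal.span {f}

/-- The image of `x` in `R`. -/
abbrev xR (f : PS k) : Rq k f := Ideal.Quotient.mk _ (X 0)
/-- The image of `y` in `R`. -/
abbrev yR (f : PS k) : Rq k f := Ideal.Quotient.mk _ (X 1)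
/-- The image of `z` in `R`. -/
abbrev zR (f : PS k) : Rq k f := Ideal.Quotient.mk _ (X 2)

/-- `L`: the localization of `R` inverting `x*y`. -/
abbrev Lloc (f : PS k) : Type := Localization.Away (xR k f * yR k f)

/-- The canonical map from the localization of `R` inverting `x` to `L`. -/
noncomputable def phiX (f : PS k) : Localization.Away (xR k f) →+* Lloc k f :=
  IsLocalization.Away.awayToAwayRight (S := Localization.Away (xR k f)) (P := Lloc k f)
    (xR k f) (yR k f)

/-- The canonical map from the localization of `R` inverting `y` to `L`. -/
noncomputable def phiY (f : PS k) : Localization.Away (yR k f) →+* Lloc k f :=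
  IsLocalization.Away.awayToAwayLeft (S := Localization.Away (yR k f)) (P := Lloc k f)
    (yR k f) (xR k f)

/-- `A ⊆ L`: the `R`-submodule generated by the images of `R_x` and `R_y` in `L`.
The quotient `L/A` is a Čech description of the local cohomology `H^2_m(R)`. -/
def Asub (f : PS k) : Submodule (Rq k f) (Lloc k f) :=
  Submodule.span (Rq k f) (Set.range (phiX k f) ∪ Set.range (phiY k f))

/-- The element `z/(x*y) ∈ L`. -/
noncomputable def zxy (f : PS k) : Lloc k f :=
  Localization.mk (zR k f) ⟨xR k f * yR k f, Submonoid.mem_powers _⟩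

/-- The element `f_j := z/(x*y^j) = z*x^(j-1)/(x*y)^j ∈ L` (for `j ≥ 1`). -/
noncomputable def fcls (f : PS k) (j : ℕ) : Lloc k f :=
  Localization.mk (zR k f * xR k f ^ (j - 1)) ⟨(xR k f * yR k f) ^ j, j, rfl⟩

/-- `N_l ⊆ 𝕎L`: the additive subgroup generated by the images of the Witt vectors of the
localizations of `R` inverting `x` and inverting `y`, together with the image of `V^l`.
The quotient `𝕎L/N_l` is a Čech description of the local cohomology `H^2_m(R, W_lO)`. -/
def Nsub (p : ℕ) [Fact p.Prime] (f : PS k) (l : ℕ) : AddSubgroup (WittVector p (Lloc k f)) :=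
  AddSubgroup.closure
    (Set.range (WittVector.map (p := p) (phiX k f) :
        WittVector p (Localization.Away (xR k f)) → WittVector p (Lloc k f)) ∪
      Set.range (WittVector.map (p := p) (phiY k f) :
        WittVector p (Localization.Away (yR k f)) → WittVector p (Lloc k f)) ∪
      Set.range ((⇑(WittVector.verschiebung (p := p) (R := Lloc k f)))^[l]))

instance : Fact (Nat.Prime 2) := ⟨by norm_num⟩

/-- The defining equation of the rational double point of type `E_7^0` in characteristic `2`. -/
abbrev fE7p0 : PS k := X 2 ^ 2 + X 0 ^ 3 + X 0 * X 1 ^ 3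

section Regularity

variable {k}

theorem X_dvd_of_X_dvd_X_sq_mul {s t : Fin 3} (hst : s ≠ t) {h : PS k}
    (H : (X s : PS k) ∣ X t ^ 2 * h) : (X s : PS k) ∣ h := by
  rw [X_dvd_iff] at H ⊢
  intro m hm
  have := H (m + Finsupp.single t 2) (by simp [hm, hst.symm])
  rwa [X_pow_eq, add_comm m, coeff_add_monomial_mul, one_mul] at this

theorem X_one_dvd_of_dvd_mul {h : PS k}
    (H : (X 1 : PS k) ∣ (X 2 ^ 2 + X 0 ^ 3) * h) : (X 1 : PS k) ∣ h := by
  rw [X_dvd_iff] at H ⊢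
  suffices ∀ n (m : Fin 3 →₀ ℕ), m 0 = n → m 1 = 0 → coeff m h = 0 from
    fun m hm => this _ m rfl hm
  intro n
  induction n using Nat.strong_induction_on with
  | _ n ih =>
    intro m h0 h1
    have := H (m + Finsupp.single 2 2) (by simp [h1])
    rw [add_mul, map_add, X_pow_eq, X_pow_eq, add_comm m, coeff_add_monomial_mul, one_mul,
      coeff_monomial_mul, one_mul] at this
    split_ifs at this with hle
    · have h3 := hle 0
      simp at h3
      rwa [ih (m 0 - 3) (by omega) (Finsupp.single 2 2 + m - Finsupp.single 0 3)
        (by simp) (by simp [h1]), add_zero] at this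
    · simpa using this

theorem mk_eq_zero_iff {f a : PS k} :
    (Ideal.Quotient.mk (Ideal.span {f}) a : Rq k f) = 0 ↔ f ∣ a := by
  rw [Ideal.Quotient.eq_zero_iff_mem, Ideal.mem_span_singleton]

theorem powerSeries_X_ne_zero (s : Fin 3) : (X s : PS k) ≠ 0 := by
  intro h
  simpa [h] using coeff_index_single_self_X (R := k) s

theorem eq_zero_of_xR_mul {a : Rq k (fE7p0 k)} (h : xR k (fE7p0 k) * a = 0) : a = 0 := by
  obtain ⟨a, rfl⟩ := Ideal.Quotient.mk_surjective a
  rw [← map_mul, mk_eq_zero_iff] at h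
  rw [mk_eq_zero_iff]
  obtain ⟨c, hc⟩ := h
  obtain ⟨d, rfl⟩ := X_dvd_of_X_dvd_X_sq_mul (k := k) (s := 0) (t := 2) (h := c) (by decide)
    ⟨a - (X 0 ^ 2 + X 1 ^ 3) * c, by linear_combination -hc⟩
  exact ⟨d, mul_left_cancel₀ (powerSeries_X_ne_zero 0) (by linear_combination hc)⟩

theorem eq_zero_of_yR_mul {a : Rq k (fE7p0 k)} (h : yR k (fE7p0 k) * a = 0) : a = 0 := by
  obtain ⟨a, rfl⟩ := Ideal.Quotient.mk_surjective a
  rw [← map_mul, mk_eq_zero_iff] at h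
  rw [mk_eq_zero_iff]
  obtain ⟨c, hc⟩ := h
  obtain ⟨d, rfl⟩ := X_one_dvd_of_dvd_mul (k := k) (h := c)
    ⟨a - X 0 * X 1 ^ 2 * c, by linear_combination -hc⟩
  exact ⟨d, mul_left_cancel₀ (powerSeries_X_ne_zero 1) (by linear_combination hc)⟩

theorem exists_eq_X_mul_add_X_sq_mul {a : PS k}
    (h : ∀ m : Fin 3 →₀ ℕ, m 0 = 0 → m 2 < 2 → coeff m a = 0) :
    ∃ b c, a = X 0 * b + X 2 ^ 2 * c := by
  let a₁ : PS k := fun m => if m 0 = 0 then coeff m a else 0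
  have h₁ (m) : coeff m a₁ = if m 0 = 0 then coeff m a else 0 := rfl
  have hx : (X 0 : PS k) ∣ a - a₁ := by
    rw [X_dvd_iff]
    intro m hm
    simp [h₁, hm]
  have hz : (X 2 ^ 2 : PS k) ∣ a₁ := by
    rw [X_pow_dvd_iff]
    intro m hm
    rw [h₁]
    split_ifs with h0
    · exact h m h0 hm
    · rfl
  obtain ⟨b, hb⟩ := hx
  obtain ⟨c, hc⟩ := hz
  exact ⟨b, c, by linear_combination hb + hc⟩

theorem xR_dvd_of_dvd_mul_yR {a : Rq k (fE7p0 k)}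
    (h : xR k (fE7p0 k) ∣ a * yR k (fE7p0 k)) : xR k (fE7p0 k) ∣ a := by
  obtain ⟨a, rfl⟩ := Ideal.Quotient.mk_surjective a
  obtain ⟨b, hb⟩ := h
  obtain ⟨b, rfl⟩ := Ideal.Quotient.mk_surjective b
  rw [← map_mul, ← map_mul, ← sub_eq_zero, ← map_sub, mk_eq_zero_iff] at hb
  obtain ⟨c, hc⟩ := hb
  have hc' : a * X 1 = X 0 * (b + (X 0 ^ 2 + X 1 ^ 3) * c) + X 2 ^ 2 * c := by
    linear_combination hc
  obtain ⟨d, e, rfl⟩ := exists_eq_X_mul_add_X_sq_mul (k := k) (a := a) fun m h0 h2 => by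
    have := congrArg (coeff (m + Finsupp.single 1 1)) hc'
    rw [X_def 1, coeff_add_mul_monomial, mul_one, map_add,
      X_dvd_iff.mp (dvd_mul_right (X 0) _) _ (by simp [h0]),
      X_pow_dvd_iff.mp (dvd_mul_right (X 2 ^ 2) c) _ (by simpa using h2), add_zero] at this
    exact this
  refine ⟨Ideal.Quotient.mk _ (d - (X 0 ^ 2 + X 1 ^ 3) * e), ?_⟩
  rw [← map_mul, ← sub_eq_zero, ← map_sub, mk_eq_zero_iff]
  exact ⟨e, by ring⟩

theorem zR_ne (a b : Rq k (fE7p0 k)) :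
    zR k (fE7p0 k) ≠ xR k (fE7p0 k) * a + yR k (fE7p0 k) * b := by
  intro h
  obtain ⟨a, rfl⟩ := Ideal.Quotient.mk_surjective a
  obtain ⟨b, rfl⟩ := Ideal.Quotient.mk_surjective b
  rw [← map_mul, ← map_mul, ← map_add, ← sub_eq_zero, ← map_sub, mk_eq_zero_iff] at h
  obtain ⟨c, hc⟩ := h
  have hc' : (X 2 : PS k) =
      X 0 * (a + (X 0 ^ 2 + X 1 ^ 3) * c) + X 1 * b + X 2 ^ 2 * c := by
    linear_combination hc
  have := congrArg (coeff (Finsupp.single (2 : Fin 3) 1)) hc'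
  rw [map_add, map_add, coeff_index_single_self_X,
    X_dvd_iff.mp (dvd_mul_right (X 0) _) _ (by simp),
    X_dvd_iff.mp (dvd_mul_right (X 1) _) _ (by simp),
    X_pow_dvd_iff.mp (dvd_mul_right (X 2 ^ 2) c) _ (by simp)] at this
  simp at this

theorem xR_dvd_of_dvd_mul_yR_pow {a : Rq k (fE7p0 k)} {m : ℕ}
    (h : xR k (fE7p0 k) ∣ a * yR k (fE7p0 k) ^ m) : xR k (fE7p0 k) ∣ a := by
  induction m with
  | zero => simpa using h
  | succ m ih =>
    rw [pow_succ, ← mul_assoc] at h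
    exact ih (xR_dvd_of_dvd_mul_yR h)

theorem xR_mul_left_cancel {a b : Rq k (fE7p0 k)}
    (h : xR k (fE7p0 k) * a = xR k (fE7p0 k) * b) : a = b :=
  sub_eq_zero.mp (eq_zero_of_xR_mul (by rw [mul_sub, h, sub_self]))

theorem xR_pow_mul_left_cancel {a b : Rq k (fE7p0 k)} (n : ℕ)
    (h : xR k (fE7p0 k) ^ n * a = xR k (fE7p0 k) ^ n * b) : a = b := by
  induction n with
  | zero => simpa using h
  | succ n ih =>
    rw [pow_succ', mul_assoc, mul_assoc] at h
    exact ih (xR_mul_left_cancel h)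

theorem xR_pow_dvd_of_dvd_mul_yR_pow {a : Rq k (fE7p0 k)} {n m : ℕ}
    (h : xR k (fE7p0 k) ^ n ∣ a * yR k (fE7p0 k) ^ m) : xR k (fE7p0 k) ^ n ∣ a := by
  induction n generalizing a with
  | zero => simp
  | succ n ih =>
    obtain ⟨c, hc⟩ := h
    obtain ⟨b, rfl⟩ := xR_dvd_of_dvd_mul_yR_pow (a := a) (m := m)
      ⟨xR k (fE7p0 k) ^ n * c, by rw [hc, pow_succ', mul_assoc]⟩
    obtain ⟨d, rfl⟩ := ih (a := b) ⟨c, xR_mul_left_cancel (by rw [← mul_assoc, hc]; ring)⟩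
    exact ⟨d, by ring⟩

theorem zR_mul_pow_ne (a b : Rq k (fE7p0 k)) (n : ℕ) :
    zR k (fE7p0 k) * (xR k (fE7p0 k) ^ n * yR k (fE7p0 k) ^ n) ≠
      a * yR k (fE7p0 k) ^ (n + 1) + b * xR k (fE7p0 k) ^ (n + 1) := by
  intro h
  obtain ⟨c, hc⟩ := xR_pow_dvd_of_dvd_mul_yR_pow (n := n + 1) (m := n)
    (a := zR k (fE7p0 k) * xR k (fE7p0 k) ^ n - a * yR k (fE7p0 k))
    ⟨b, by linear_combination h⟩
  obtain ⟨d, rfl⟩ := xR_pow_dvd_of_dvd_mul_yR_pow (n := n) (m := 1) (a := a)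
    ⟨zR k (fE7p0 k) - xR k (fE7p0 k) * c, by linear_combination -hc⟩
  exact zR_ne c d (xR_pow_mul_left_cancel n (by linear_combination hc))

theorem xR_mul_yR_mem_nonZeroDivisors :
    xR k (fE7p0 k) * yR k (fE7p0 k) ∈ nonZeroDivisors (Rq k (fE7p0 k)) := by
  rw [mem_nonZeroDivisors_iff_right]
  intro a ha
  exact eq_zero_of_xR_mul (eq_zero_of_yR_mul (by rw [← ha]; ring))

theorem algebraMap_Lloc_injective :
    Function.Injective (algebraMap (Rq k (fE7p0 k)) (Lloc k (fE7p0 k))) :=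
  IsLocalization.injective _ (M := Submonoid.powers (xR k (fE7p0 k) * yR k (fE7p0 k)))
    (Submonoid.powers_le.mpr xR_mul_yR_mem_nonZeroDivisors)

end Regularity

section Localization

variable {k} {f : PS k}

theorem isUnit_algebraMap_xR_mul_yR :
    IsUnit (algebraMap (Rq k f) (Lloc k f) (xR k f) * algebraMap (Rq k f) (Lloc k f) (yR k f)) := by
  have := IsLocalization.Away.algebraMap_isUnit (S := Lloc k f) (xR k f * yR k f)
  rwa [map_mul] at this

theorem isUnit_algebraMap_xR : IsUnit (algebraMap (Rq k f) (Lloc k f) (xR k f)) :=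
  isUnit_of_mul_isUnit_left isUnit_algebraMap_xR_mul_yR

theorem isUnit_algebraMap_yR : IsUnit (algebraMap (Rq k f) (Lloc k f) (yR k f)) :=
  isUnit_of_mul_isUnit_right isUnit_algebraMap_xR_mul_yR

theorem phiX_algebraMap (a : Rq k f) :
    phiX k f (algebraMap _ _ a) = algebraMap _ (Lloc k f) a :=
  IsLocalization.Away.awayToAwayRight_eq _ _ _

theorem phiY_algebraMap (a : Rq k f) :
    phiY k f (algebraMap _ _ a) = algebraMap _ (Lloc k f) a :=
  IsLocalization.Away.awayToAwayLeft_eq _ _ _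

theorem mem_range_phiX {u : Lloc k f} : u ∈ (phiX k f).range ↔
    ∃ (n : ℕ) (a : Rq k f), u * algebraMap (Rq k f) (Lloc k f) (xR k f) ^ n = algebraMap _ _ a := by
  constructor
  · rintro ⟨v, rfl⟩
    obtain ⟨n, a, h⟩ := IsLocalization.Away.surj (xR k f) v
    refine ⟨n, a, ?_⟩
    rw [← phiX_algebraMap, ← phiX_algebraMap a, ← h, map_mul, map_pow]
  · rintro ⟨n, a, h⟩
    refine ⟨IsLocalization.mk' _ a
      (⟨xR k f ^ n, n, rfl⟩ : Submonoid.powers (xR k f)), ?_⟩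
    have := congrArg (phiX k f) (IsLocalization.mk'_spec (Localization.Away (xR k f)) a
      (⟨xR k f ^ n, n, rfl⟩ : Submonoid.powers (xR k f)))
    rw [map_mul, phiX_algebraMap, phiX_algebraMap, ← h, map_pow] at this
    exact (isUnit_algebraMap_xR.pow n).mul_right_cancel this

theorem mem_range_phiY {u : Lloc k f} : u ∈ (phiY k f).range ↔
    ∃ (n : ℕ) (a : Rq k f), u * algebraMap (Rq k f) (Lloc k f) (yR k f) ^ n = algebraMap _ _ a := by
  constructor
  · rintro ⟨v, rfl⟩
    obtain ⟨n, a, h⟩ := IsLocalization.Away.surj (yR k f) v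
    refine ⟨n, a, ?_⟩
    rw [← phiY_algebraMap, ← phiY_algebraMap a, ← h, map_mul, map_pow]
  · rintro ⟨n, a, h⟩
    refine ⟨IsLocalization.mk' _ a
      (⟨yR k f ^ n, n, rfl⟩ : Submonoid.powers (yR k f)), ?_⟩
    have := congrArg (phiY k f) (IsLocalization.mk'_spec (Localization.Away (yR k f)) a
      (⟨yR k f ^ n, n, rfl⟩ : Submonoid.powers (yR k f)))
    rw [map_mul, phiY_algebraMap, phiY_algebraMap, ← h, map_pow] at this
    exact (isUnit_algebraMap_yR.pow n).mul_right_cancel this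

theorem zxy_mul : zxy k f * (algebraMap (Rq k f) (Lloc k f) (xR k f) *
    algebraMap (Rq k f) (Lloc k f) (yR k f)) = algebraMap _ _ (zR k f) := by
  have := IsLocalization.mk'_spec (Lloc k f) (zR k f)
    (⟨xR k f * yR k f, Submonoid.mem_powers _⟩ : Submonoid.powers (xR k f * yR k f))
  rw [map_mul] at this
  rw [← this, zxy, Localization.mk_eq_mk']

theorem zxy_ne_add {u v : Lloc k (fE7p0 k)}
    (hu : u ∈ (phiX k (fE7p0 k)).range) (hv : v ∈ (phiY k (fE7p0 k)).range) :
    zxy k (fE7p0 k) ≠ u + v := by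
  intro h
  obtain ⟨n, a, ha⟩ := mem_range_phiX.mp hu
  obtain ⟨m, b, hb⟩ := mem_range_phiY.mp hv
  have hz := zxy_mul (f := fE7p0 k)
  refine zR_mul_pow_ne (a * xR k (fE7p0 k) ^ (m + 1)) (b * yR k (fE7p0 k) ^ (n + 1)) (n + m)
    (algebraMap_Lloc_injective ?_)
  simp only [map_mul, map_pow, map_add, ← hz, ← ha, ← hb, h]
  ring

end Localization

namespace WittVector

variable {p : ℕ} [Fact p.Prime] {S T L : Type*} [CommRing S] [CommRing T] [CommRing L]

theorem mem_range_map {φ : S →+* L} {w : WittVector p L} :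
    w ∈ (map (p := p) φ).range ↔ ∀ n, w.coeff n ∈ φ.range := by
  constructor
  · rintro ⟨v, rfl⟩ n
    exact ⟨v.coeff n, (map_coeff φ v n).symm⟩
  · intro h
    choose c hc using h
    exact ⟨mk p c, by ext n; rw [map_coeff, coeff_mk, hc]⟩

theorem teichmuller_mem_range_map {φ : S →+* L} {u : L} (hu : u ∈ φ.range) :
    teichmuller p u ∈ (map (p := p) φ).range := by
  obtain ⟨v, rfl⟩ := hu
  exact ⟨teichmuller p v, map_teichmuller p φ v⟩

theorem verschiebung_mem_range_map {φ : S →+* L} {w : WittVector p L}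
    (hw : w ∈ (map (p := p) φ).range) : verschiebung w ∈ (map (p := p) φ).range := by
  obtain ⟨v, rfl⟩ := hw
  exact ⟨verschiebung v, map_verschiebung φ v⟩

theorem exists_verschiebung_eq {w : WittVector p L} (h : w.coeff 0 = 0) :
    ∃ v, verschiebung v = w :=
  ⟨w.shift 1, (eq_iterate_verschiebung (n := 1) fun i hi => by
    rwa [Nat.lt_one_iff.mp hi]).symm⟩

theorem exists_mem_range_map_verschiebung_eq {φ : S →+* L} {w : WittVector p L}
    (hw : w ∈ (map (p := p) φ).range) (h : w.coeff 0 = 0) :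
    ∃ v ∈ (map (p := p) φ).range, verschiebung v = w := by
  obtain ⟨v, rfl⟩ := exists_verschiebung_eq h
  refine ⟨v, mem_range_map.mpr fun n => ?_, rfl⟩
  rw [← verschiebung_coeff_succ]
  exact mem_range_map.mp hw _

theorem exists_eq_add_of_verschiebung_eq_add {φ : S →+* L} {ψ : T →+* L}
    {w α β δ : WittVector p L} (hα : α ∈ (map (p := p) φ).range)
    (hβ : β ∈ (map (p := p) ψ).range) (h : verschiebung w = α + β + verschiebung δ) :
    ∃ α' ∈ (map (p := p) φ).range, ∃ β' ∈ (map (p := p) ψ).range, w = α' + β' + δ := by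
  have h0 : α.coeff 0 + β.coeff 0 = 0 := by
    have := congrArg (constantCoeff : WittVector p L →+* L) h
    simp only [map_add, constantCoeff_apply, verschiebung_coeff_zero, add_zero] at this
    exact this.symm
  have hψ : α.coeff 0 ∈ ψ.range := by
    rw [eq_neg_of_add_eq_zero_left h0]
    exact neg_mem (mem_range_map.mp hβ 0)
  obtain ⟨α', hα', hα''⟩ := exists_mem_range_map_verschiebung_eq
    (sub_mem hα (teichmuller_mem_range_map (mem_range_map.mp hα 0)))
    (by rw [← constantCoeff_apply, map_sub, constantCoeff_apply, constantCoeff_apply,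
      teichmuller_coeff_zero, sub_self])
  obtain ⟨β', hβ', hβ''⟩ := exists_mem_range_map_verschiebung_eq
    (add_mem hβ (teichmuller_mem_range_map hψ))
    (by rw [add_coeff_zero, teichmuller_coeff_zero, add_comm, h0])
  refine ⟨α', hα', β', hβ', verschiebung_injective p L ?_⟩
  rw [map_add, map_add, hα'', hβ'', h]
  abel

theorem coeff_eq_zero_of_ghostComponent_eq_zero [IsDomain L] [CharZero L] {w : WittVector 2 L}
    (h0 : ghostComponent 0 w = 0) (h1 : ghostComponent 1 w = 0) (h2 : ghostComponent 2 w = 0) :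
    ∀ i < 3, w.coeff i = 0 := by
  simp only [ghostComponent_apply, wittPolynomial_eq_sum_C_mul_X_pow, Finset.sum_range_succ,
    Finset.range_zero, Finset.sum_empty, map_add, map_mul, map_pow, MvPolynomial.aeval_X] at h0 h1 h2
  norm_num at h0 h1 h2
  simp [h0] at h1
  simp [h0, h1] at h2
  intro i hi
  interval_cases i <;> assumption

theorem exists_teichmuller_add_eq (a b : L) : ∃ γ : WittVector 2 L,
    teichmuller 2 (a + b) = teichmuller 2 a + teichmuller 2 b +
      verschiebung (teichmuller 2 (a * b)) +
      verschiebung (verschiebung (teichmuller 2 (a ^ 3 * b + a ^ 2 * b ^ 2 + a * b ^ 3))) +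
      verschiebung (verschiebung (verschiebung γ)) := by
  let x : MvPolynomial (Fin 2) ℤ := MvPolynomial.X 0
  let y : MvPolynomial (Fin 2) ℤ := MvPolynomial.X 1
  let D := teichmuller 2 (x + y) - (teichmuller 2 x + teichmuller 2 y +
    verschiebung (teichmuller 2 (x * y)) +
    verschiebung (verschiebung (teichmuller 2 (x ^ 3 * y + x ^ 2 * y ^ 2 + x * y ^ 3))))
  have hD : ∀ i < 3, D.coeff i = 0 := by
    apply coeff_eq_zero_of_ghostComponent_eq_zero
    · simp only [D, map_sub, map_add, ghostComponent_teichmuller,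
        ghostComponent_zero_verschiebung]
      ring
    · simp only [D, map_sub, map_add, ghostComponent_teichmuller,
        ghostComponent_zero_verschiebung, ghostComponent_verschiebung (n := 0)]
      push_cast
      ring
    · simp only [D, map_sub, map_add, ghostComponent_teichmuller,
        ghostComponent_verschiebung (n := 0), ghostComponent_verschiebung (n := 1)]
      push_cast
      ring
  have hD' := congrArg (map (MvPolynomial.aeval ![a, b] : _ →ₐ[ℤ] L).toRingHom)
    (eq_iterate_verschiebung hD)
  refine ⟨map (MvPolynomial.aeval ![a, b] : _ →ₐ[ℤ] L).toRingHom (D.shift 3), ?_⟩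
  simp only [Function.iterate_succ, Function.iterate_zero, Function.comp, id, map_verschiebung] at hD'
  rw [← hD']
  simp [D, map_sub, map_add, map_verschiebung, map_teichmuller, x, y]

end WittVector

section CechSubgroup

variable {k} {f : PS k}

theorem exists_eq_add_of_mem_Nsub {p : ℕ} [Fact p.Prime] {l : ℕ} {w : WittVector p (Lloc k f)}
    (hw : w ∈ Nsub k p f l) :
    ∃ α ∈ (WittVector.map (p := p) (phiX k f)).range,
      ∃ β ∈ (WittVector.map (p := p) (phiY k f)).range,
        ∃ γ, w = α + β + (⇑(WittVector.verschiebung (p := p)))^[l] γ := by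
  induction hw using AddSubgroup.closure_induction with
  | mem w hw =>
    rcases hw with (hw | hw) | ⟨γ, rfl⟩
    · exact ⟨w, hw, 0, zero_mem _, 0, by simp [iterate_map_zero]⟩
    · exact ⟨0, zero_mem _, w, hw, 0, by simp [iterate_map_zero]⟩
    · exact ⟨0, zero_mem _, 0, zero_mem _, γ, by simp⟩
  | zero => exact ⟨0, zero_mem _, 0, zero_mem _, 0, by simp [iterate_map_zero]⟩
  | add w w' _ _ h h' =>
    obtain ⟨α, hα, β, hβ, γ, rfl⟩ := h
    obtain ⟨α', hα', β', hβ', γ', rfl⟩ := h'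
    exact ⟨α + α', add_mem hα hα', β + β', add_mem hβ hβ', γ + γ', by
      rw [iterate_map_add]; abel⟩
  | neg w _ h =>
    obtain ⟨α, hα, β, hβ, γ, rfl⟩ := h
    exact ⟨-α, neg_mem hα, -β, neg_mem hβ, -γ, by rw [iterate_map_neg]; abel⟩

theorem mem_Nsub_of_mem_range_phiX {p : ℕ} [Fact p.Prime] {l : ℕ} {w : WittVector p (Lloc k f)}
    (hw : w ∈ (WittVector.map (p := p) (phiX k f)).range) : w ∈ Nsub k p f l :=
  AddSubgroup.subset_closure (Or.inl (Or.inl hw))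

theorem mem_Nsub_of_mem_range_phiY {p : ℕ} [Fact p.Prime] {l : ℕ} {w : WittVector p (Lloc k f)}
    (hw : w ∈ (WittVector.map (p := p) (phiY k f)).range) : w ∈ Nsub k p f l :=
  AddSubgroup.subset_closure (Or.inl (Or.inr hw))

theorem iterate_verschiebung_mem_Nsub {p : ℕ} [Fact p.Prime] {l : ℕ}
    (w : WittVector p (Lloc k f)) :
    (⇑(WittVector.verschiebung (p := p)))^[l] w ∈ Nsub k p f l :=
  AddSubgroup.subset_closure (Or.inr ⟨w, rfl⟩)

theorem verschiebung_mem_Nsub {p : ℕ} [Fact p.Prime] {l : ℕ} {w : WittVector p (Lloc k f)}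
    (hw : w ∈ Nsub k p f l) : WittVector.verschiebung w ∈ Nsub k p f l := by
  obtain ⟨α, hα, β, hβ, γ, rfl⟩ := exists_eq_add_of_mem_Nsub hw
  rw [map_add, map_add, ← Function.iterate_succ_apply' (⇑WittVector.verschiebung),
    Function.iterate_succ_apply]
  exact add_mem (add_mem
    (mem_Nsub_of_mem_range_phiX (WittVector.verschiebung_mem_range_map hα))
    (mem_Nsub_of_mem_range_phiY (WittVector.verschiebung_mem_range_map hβ)))
    (iterate_verschiebung_mem_Nsub _)

open WittVector in
theorem verschiebung_verschiebung_teichmuller_zxy_notMem :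
    verschiebung (verschiebung (teichmuller 2 (zxy k (fE7p0 k)))) ∉ Nsub k 2 (fE7p0 k) 3 := by
  intro h
  obtain ⟨α, hα, β, hβ, γ, h⟩ := exists_eq_add_of_mem_Nsub h
  obtain ⟨α, hα, β, hβ, h⟩ := exists_eq_add_of_verschiebung_eq_add hα hβ h
  obtain ⟨α, hα, β, hβ, h⟩ := exists_eq_add_of_verschiebung_eq_add hα hβ h
  have h0 := congrArg (constantCoeff : WittVector 2 (Lloc k (fE7p0 k)) →+* _) h
  simp only [map_add, constantCoeff_apply, verschiebung_coeff_zero, add_zero,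
    teichmuller_coeff_zero] at h0
  exact zxy_ne_add (mem_range_map.mp hα 0) (mem_range_map.mp hβ 0) h0

theorem nontrivial_Lloc_fE7p0 : Nontrivial (Lloc k (fE7p0 k)) :=
  ⟨zxy k (fE7p0 k), 0, fun h => zxy_ne_add (zero_mem _) (zero_mem _) (h.trans (add_zero 0).symm)⟩

theorem charP_Lloc_fE7p0 [CharP k 2] : CharP (Lloc k (fE7p0 k)) 2 := by
  have := nontrivial_Lloc_fE7p0 (k := k)
  exact charP_of_injective_ringHom (f := (algebraMap (Rq k (fE7p0 k)) (Lloc k (fE7p0 k))).comp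
    ((Ideal.Quotient.mk _).comp (C : k →+* PS k))) (RingHom.injective _) 2

theorem exists_zxy_sq_eq_add [CharP k 2] : ∃ a ∈ (phiY k (fE7p0 k)).range,
    ∃ b ∈ (phiX k (fE7p0 k)).range, zxy k (fE7p0 k) ^ 2 = a + b ∧
      a * b ∈ (phiY k (fE7p0 k)).range ∧ a * b ^ 3 ∈ (phiX k (fE7p0 k)).range := by
  have := charP_Lloc_fE7p0 (k := k)
  have h2 : (2 : Lloc k (fE7p0 k)) = 0 := CharTwo.two_eq_zero
  obtain ⟨x', hx'⟩ := isUnit_iff_exists_inv.mp (isUnit_algebraMap_xR (f := fE7p0 k))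
  obtain ⟨y', hy'⟩ := isUnit_iff_exists_inv.mp (isUnit_algebraMap_yR (f := fE7p0 k))
  have hz := zxy_mul (f := fE7p0 k)
  have hf : zR k (fE7p0 k) ^ 2 + xR k (fE7p0 k) ^ 3 + xR k (fE7p0 k) * yR k (fE7p0 k) ^ 3 = 0 := by
    simp only [← map_mul, ← map_pow, ← map_add]
    exact mk_eq_zero_iff.mpr dvd_rfl
  have hf' := congrArg (algebraMap _ (Lloc k (fE7p0 k))) hf
  simp only [map_add, map_mul, map_pow, map_zero, ← hz] at hf'
  have hx₁ : x' ∈ (phiX k (fE7p0 k)).range :=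
    mem_range_phiX.mpr ⟨1, 1, by rw [pow_one, mul_comm, hx', map_one]⟩
  have hy₁ : y' ∈ (phiY k (fE7p0 k)).range :=
    mem_range_phiY.mpr ⟨1, 1, by rw [pow_one, mul_comm, hy', map_one]⟩
  have hX (r) : algebraMap (Rq k (fE7p0 k)) (Lloc k (fE7p0 k)) r ∈ (phiX k (fE7p0 k)).range :=
    ⟨_, phiX_algebraMap r⟩
  have hY (r) : algebraMap (Rq k (fE7p0 k)) (Lloc k (fE7p0 k)) r ∈ (phiY k (fE7p0 k)).range :=
    ⟨_, phiY_algebraMap r⟩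
  have hX₁ := hX (yR k (fE7p0 k))
  have hY₁ := hY (xR k (fE7p0 k))
  generalize algebraMap (Rq k (fE7p0 k)) (Lloc k (fE7p0 k)) (xR k (fE7p0 k)) = x at *
  generalize algebraMap (Rq k (fE7p0 k)) (Lloc k (fE7p0 k)) (yR k (fE7p0 k)) = y at *
  generalize zxy k (fE7p0 k) = t at *
  refine ⟨x * y' ^ 2, mul_mem hY₁ (pow_mem hy₁ 2), y * x', mul_mem hX₁ hx₁, ?_, ?_, ?_⟩
  · have e : t ^ 2 * (x * y) ^ 2 * (x' * y') ^ 2 =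
        (x ^ 3 + x * y ^ 3) * (x' * y') ^ 2 := by
      linear_combination (x' * y') ^ 2 * hf' - (x' * y') ^ 2 * (x ^ 3 + x * y ^ 3) * h2
    have e₁ : t ^ 2 * (x * y) ^ 2 * (x' * y') ^ 2 = t ^ 2 * (x * x') ^ 2 * (y * y') ^ 2 := by ring
    have e₂ : (x ^ 3 + x * y ^ 3) * (x' * y') ^ 2 =
        (x * x') ^ 2 * (x * y' ^ 2) + (x * x') * (y * y') ^ 2 * (y * x') := by ring
    rw [e₁, e₂, hx', hy'] at e
    simpa using e
  · rw [show x * y' ^ 2 * (y * x') = (x * x') * (y * y') * y' by ring, hx', hy']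
    simpa using hy₁
  · rw [show x * y' ^ 2 * (y * x') ^ 3 = (x * x') * (y * y') ^ 2 * (y * x' ^ 2) by ring, hx', hy']
    simpa using mul_mem hX₁ (pow_mem hx₁ 2)

open WittVector in
theorem frobenius_teichmuller_zxy_mem [CharP k 2] :
    frobenius (teichmuller 2 (zxy k (fE7p0 k))) ∈ Nsub k 2 (fE7p0 k) 3 := by
  have := charP_Lloc_fE7p0 (k := k)
  obtain ⟨a, ha, b, hb, hab, hm, hm'⟩ := exists_zxy_sq_eq_add (k := k)
  rw [frobenius_eq_map_frobenius, map_teichmuller, frobenius_def, hab]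
  obtain ⟨γ, hγ⟩ := exists_teichmuller_add_eq a b
  obtain ⟨δ, hδ⟩ := exists_teichmuller_add_eq (a ^ 3 * b + a ^ 2 * b ^ 2) (a * b ^ 3)
  have hY : a ^ 3 * b + a ^ 2 * b ^ 2 ∈ (phiY k (fE7p0 k)).range := by
    rw [show a ^ 3 * b + a ^ 2 * b ^ 2 = a ^ 2 * (a * b) + (a * b) ^ 2 by ring]
    exact add_mem (mul_mem (pow_mem ha 2) hm) (pow_mem hm 2)
  rw [hγ, hδ]
  refine add_mem (add_mem (add_mem (add_mem ?_ ?_) ?_) ?_) (iterate_verschiebung_mem_Nsub γ)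
  · exact mem_Nsub_of_mem_range_phiY (teichmuller_mem_range_map ha)
  · exact mem_Nsub_of_mem_range_phiX (teichmuller_mem_range_map hb)
  · exact mem_Nsub_of_mem_range_phiY (verschiebung_mem_range_map (teichmuller_mem_range_map hm))
  · simp only [map_add]
    refine add_mem (add_mem (add_mem (add_mem ?_ ?_) ?_) ?_) ?_
    · exact verschiebung_mem_Nsub (verschiebung_mem_Nsub
        (mem_Nsub_of_mem_range_phiY (teichmuller_mem_range_map hY)))
    · exact verschiebung_mem_Nsub (verschiebung_mem_Nsub
        (mem_Nsub_of_mem_range_phiX (teichmuller_mem_range_map hm')))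
    · exact iterate_verschiebung_mem_Nsub _
    · exact verschiebung_mem_Nsub (iterate_verschiebung_mem_Nsub _)
    · exact verschiebung_mem_Nsub (verschiebung_mem_Nsub (iterate_verschiebung_mem_Nsub _))

end CechSubgroup

/-- For the rational double point of type `E_7^0` in characteristic `2`,
with `τ` the Teichmüller lift of `z/(xy)` in `𝕎L`: `F(τ) ∈ N₃`, `τ ∉ N₃`, `V(τ) ∉ N₃` and
`V²(τ) ∉ N₃`; i.e. the class of the length-3 Teichmüller lift of `z/(xy)` in `H^2_m(R, W₃O)`
is annihilated by Frobenius but not by `V` or `V²`. This realizes the relations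
`F ≡ V³ ≡ 0` on the generator `f₁⁽³⁾` of the Dieudonné module of `E_7^0` in
characteristic 2, which has length 3 (corresponding to `Picloc^{loc,loc} ≅ α₈`). -/
theorem wittLocalCohomology_E7p0_char2 (k : Type) [Field k] [IsAlgClosed k] [CharP k 2] :
    -- (i) F(τ) ∈ N₃
    WittVector.frobeniusFun (WittVector.teichmuller 2 (zxy k (fE7p0 k)))
      ∈ Nsub k 2 (fE7p0 k) 3 ∧
    -- (ii) τ ∉ N₃
    WittVector.teichmuller 2 (zxy k (fE7p0 k)) ∉ Nsub k 2 (fE7p0 k) 3 ∧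
    -- (iii) V(τ) ∉ N₃
    WittVector.verschiebung (WittVector.teichmuller 2 (zxy k (fE7p0 k)))
      ∉ Nsub k 2 (fE7p0 k) 3 ∧
    -- (iv) V²(τ) ∉ N₃
    WittVector.verschiebung (WittVector.verschiebung (WittVector.teichmuller 2 (zxy k (fE7p0 k))))
      ∉ Nsub k 2 (fE7p0 k) 3 := by
  have h := verschiebung_verschiebung_teichmuller_zxy_notMem (k := k)
  exact ⟨frobenius_teichmuller_zxy_mem,
    fun h' => h (verschiebung_mem_Nsub (verschiebung_mem_Nsub h')),
    fun h' => h (verschiebung_mem_Nsub h'), h⟩
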